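/- (Rank-one recovery formula from frame intensity measurements) Let K ≥ 2, M = K², and let α_1, …, α_M ∈ ℂ^K form a 2-uniform M/K-tight frame. Then for every x ∈ ℂ^K, the rank-one Hermitian matrix Q = x·x^* satisfies Q = ((K+1)/K) · Σ_{m=1}^{M} |⟨x, α_m⟩|² · α_m·α_m^* − (1/K) · ( Σ_{m=1}^{M} |⟨x, α_m⟩|² ) · I, where I is the K×K identity matrix. In particular, the numbers |⟨x, α_m⟩|², m = 1, …, M, determine x up to multiplication by a unimodular constant. -/

import Mathlib

open Complex Finset
open scoped ComplexConjugate

noncomputable section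

/-- The squared modulus of a frame coefficient, expanded over pairs of coordinates. -/
lemma norm_sq_sum_mul_conj {ι : Type*} [Fintype ι] (x a : ι → ℂ) :
    ((‖∑ i, x i * conj (a i)‖ ^ 2 : ℝ) : ℂ) =
      ∑ j, ∑ k, (x j * conj (x k)) * (conj (a j) * a k) := by
  rw [ofReal_pow, ← Complex.mul_conj', map_sum, Finset.sum_mul_sum]
  refine Finset.sum_congr rfl fun j _ => Finset.sum_congr rfl fun k _ => ?_
  simp only [map_mul, Complex.conj_conj]
  ring

/-- The rank-one matrices of an equiangular system of `K²` unit vectors form a basis of the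
`K × K` matrices, with an explicit dual basis. -/
lemma sum_dual_mul_rankOne (K : ℕ) (hK : K ≠ 0) (α : Fin (K ^ 2) → Fin K → ℂ)
    (hnorm : ∀ m, ∑ k, ‖α m k‖ ^ 2 = 1)
    (huniform : ∀ m l, m ≠ l → ‖∑ k, α m k * conj (α l k)‖ ^ 2 = 1 / (K + 1))
    (j k p q : Fin K) :
    ∑ m, ((K + 1 : ℂ) / K * (conj (α m j) * α m k) - (1 / K) * (if j = k then 1 else 0)) *
        (α m p * conj (α m q)) = if (j, k) = (p, q) then 1 else 0 := by
  have hK0 : (K : ℂ) ≠ 0 := Nat.cast_ne_zero.mpr hK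
  have hK1 : (K + 1 : ℂ) ≠ 0 := Nat.cast_add_one_ne_zero K
  have hnormC (m) : ∑ k, α m k * conj (α m k) = 1 := by
    simp_rw [Complex.mul_conj']
    exact_mod_cast hnorm m
  let V : Matrix (Fin (K ^ 2)) (Fin K × Fin K) ℂ :=
    Matrix.of fun m s => α m s.1 * conj (α m s.2)
  let W : Matrix (Fin K × Fin K) (Fin (K ^ 2)) ℂ :=
    Matrix.of fun s m => (K + 1 : ℂ) / K * (conj (α m s.1) * α m s.2) -
      (1 / K) * (if s.1 = s.2 then 1 else 0)
  have hVW : V * W = 1 := by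
    ext l m
    have h : (V * W) l m = (K + 1 : ℂ) / K * ((‖∑ i, α l i * conj (α m i)‖ ^ 2 : ℝ) : ℂ)
        - 1 / K := by
      rw [norm_sq_sum_mul_conj, Matrix.mul_apply, Fintype.sum_prod_type]
      have h1 : (1 / K : ℂ) = ∑ j, ∑ k, (α l j * conj (α l k)) *
          ((1 / K) * (if j = k then 1 else 0)) := by
        simp only [mul_ite, mul_one, mul_zero, Finset.sum_ite_eq, Finset.mem_univ, if_true]
        rw [← Finset.sum_mul, hnormC, one_mul]
      rw [h1]
      simp only [Finset.mul_sum, ← Finset.sum_sub_distrib]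
      refine Finset.sum_congr rfl fun j _ => Finset.sum_congr rfl fun k _ => ?_
      simp only [V, W, Matrix.of_apply]
      ring
    rw [h, Matrix.one_apply]
    split_ifs with hlm
    · subst hlm
      rw [hnormC]
      simp only [norm_one]
      push_cast
      field_simp
      ring
    · rw [huniform l m hlm]
      push_cast
      field_simp
      ring
  have e : Fin (K ^ 2) ≃ Fin K × Fin K :=
    Fintype.equivOfCardEq (by simp [sq])
  have hWV : W * V = 1 := (Matrix.mul_eq_one_comm_of_equiv e).mp hVW
  have h := congrFun (congrFun hWV (j, k)) (p, q)
  rwa [Matrix.mul_apply, Matrix.one_apply] at h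

/-- Two vectors with the same rank-one matrix agree up to a unimodular factor. -/
lemma exists_phase_of_rankOne_eq {ι : Type*} (x y : ι → ℂ)
    (h : ∀ j k, x j * conj (x k) = y j * conj (y k)) :
    ∃ θ : ℝ, ∀ k, y k = Complex.exp (θ * Complex.I) * x k := by
  have hn (k) : ‖x k‖ = ‖y k‖ := by
    have := h k k
    rw [Complex.mul_conj', Complex.mul_conj'] at this
    exact (sq_eq_sq₀ (norm_nonneg _) (norm_nonneg _)).mp (by exact_mod_cast this)
  by_cases hx : ∃ j, x j ≠ 0
  · obtain ⟨j, hj⟩ := hx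
    have hy : y j ≠ 0 := norm_ne_zero_iff.mp (hn j ▸ norm_ne_zero_iff.mpr hj)
    have hu : ‖y j / x j‖ = 1 := by
      rw [norm_div, hn j, div_self (norm_ne_zero_iff.mpr hy)]
    have hexp := Complex.norm_mul_exp_arg_mul_I (y j / x j)
    rw [hu, ofReal_one, one_mul] at hexp
    refine ⟨(y j / x j).arg, fun k => ?_⟩
    have hyc : conj (y j) ≠ 0 := (map_ne_zero _).mpr hy
    rw [hexp, div_mul_eq_mul_div, eq_div_iff hj]
    apply mul_right_cancel₀ hyc
    linear_combination (-x j) * h k j + x k * h j j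
  · push Not at hx
    refine ⟨0, fun k => ?_⟩
    rw [hx k, mul_zero, ← norm_eq_zero, ← hn k, hx k, norm_zero]

/-- Rank-one recovery formula from the intensity measurements of a 2-uniform `M/K`-tight
frame with `M = K²` vectors, and the resulting determination of `x` up to a unimodular
constant. -/
theorem stmt_5 (K : ℕ) (hK : 2 ≤ K) (α : Fin (K ^ 2) → Fin K → ℂ)
    (hnorm : ∀ m, ∑ k, ‖α m k‖ ^ 2 = 1)
    (htight : ∀ j k : Fin K, ∑ m, α m j * conj (α m k) =
      ((K ^ 2 : ℂ) / K) * (if j = k then 1 else 0))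
    (huniform : ∀ m l, m ≠ l → ‖∑ k, α m k * conj (α l k)‖ ^ 2 = 1 / (K + 1)) :
    (∀ x : Fin K → ℂ, ∀ j k : Fin K,
      x j * conj (x k) =
        ((K + 1 : ℂ) / K) *
            ∑ m, ((‖∑ i, x i * conj (α m i)‖ ^ 2 : ℝ) : ℂ) * (α m j * conj (α m k))
          - (1 / (K : ℂ)) * ((∑ m, ‖∑ i, x i * conj (α m i)‖ ^ 2 : ℝ) : ℂ) *
              (if j = k then 1 else 0)) ∧
    (∀ x y : Fin K → ℂ,
      (∀ m, ‖∑ i, x i * conj (α m i)‖ ^ 2 = ‖∑ i, y i * conj (α m i)‖ ^ 2) →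
      ∃ θ : ℝ, ∀ k, y k = Complex.exp (θ * Complex.I) * x k) := by
  have hK0 : (K : ℂ) ≠ 0 := Nat.cast_ne_zero.mpr (by omega)
  have recovery : ∀ x : Fin K → ℂ, ∀ j k : Fin K,
      x j * conj (x k) =
        ((K + 1 : ℂ) / K) *
            ∑ m, ((‖∑ i, x i * conj (α m i)‖ ^ 2 : ℝ) : ℂ) * (α m j * conj (α m k))
          - (1 / (K : ℂ)) * ((∑ m, ‖∑ i, x i * conj (α m i)‖ ^ 2 : ℝ) : ℂ) *
              (if j = k then 1 else 0) := by
    intro x p q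
    have htotal : ((∑ m, ‖∑ i, x i * conj (α m i)‖ ^ 2 : ℝ) : ℂ) =
        K * ∑ j, x j * conj (x j) := by
      rw [ofReal_sum]
      simp_rw [norm_sq_sum_mul_conj]
      rw [Finset.sum_comm, Finset.mul_sum]
      refine Finset.sum_congr rfl fun j _ => ?_
      rw [Finset.sum_comm]
      simp_rw [← Finset.mul_sum, mul_comm (conj (α _ j)), htight]
      simp only [mul_ite, mul_one, mul_zero, Finset.sum_ite_eq', Finset.mem_univ, if_true]
      field_simp
    have hcoeff (m) : ∑ j, ∑ k, (x j * conj (x k)) *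
        ((K + 1 : ℂ) / K * (conj (α m j) * α m k) - (1 / K) * (if j = k then 1 else 0)) =
        (K + 1 : ℂ) / K * ((‖∑ i, x i * conj (α m i)‖ ^ 2 : ℝ) : ℂ)
          - 1 / K * ∑ j, x j * conj (x j) := by
      rw [norm_sq_sum_mul_conj]
      simp only [mul_sub, Finset.sum_sub_distrib]
      congr 1
      · simp only [Finset.mul_sum]
        refine Finset.sum_congr rfl fun j _ => Finset.sum_congr rfl fun k _ => ?_
        ring
      · simp only [mul_ite, mul_one, mul_zero, Finset.sum_ite_eq, Finset.mem_univ, if_true]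
        rw [← Finset.sum_mul, mul_comm]
    calc x p * conj (x q)
        = ∑ j, ∑ k, (x j * conj (x k)) * (if (j, k) = (p, q) then 1 else 0) := by
          rw [← Fintype.sum_prod_type' (f := fun j k =>
            (x j * conj (x k)) * (if (j, k) = (p, q) then 1 else 0))]
          simp
      _ = ∑ m, (∑ j, ∑ k, (x j * conj (x k)) *
            ((K + 1 : ℂ) / K * (conj (α m j) * α m k) - (1 / K) * (if j = k then 1 else 0))) *
              (α m p * conj (α m q)) := by
          simp_rw [← sum_dual_mul_rankOne K (by omega) α hnorm huniform, Finset.mul_sum,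
            Finset.sum_mul]
          rw [Finset.sum_comm (s := (univ : Finset (Fin (K ^ 2))))]
          refine Finset.sum_congr rfl fun j _ => ?_
          rw [Finset.sum_comm]
          simp only [mul_assoc]
      _ = _ := by
          simp_rw [hcoeff, sub_mul, Finset.sum_sub_distrib, mul_assoc, ← Finset.mul_sum, htight,
            htotal]
          field_simp
  refine ⟨recovery, fun x y hxy => exists_phase_of_rankOne_eq x y fun j k => ?_⟩
  rw [recovery x j k, recovery y j k]
  simp only [hxy]
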